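/- arXiv:2507.17646 — 2 statements merged into one kernel-verified Lean document; each statement's English description precedes it below -/
import Mathlib

section
/- Let G be a finite connected simple graph having a cut-vertex. Then G is 2-γ'MB-critical if and only if G is isomorphic to a graph in the family 𝓕 ∪ 𝓕'. -/
/-- `D` is a dominating set of `G`: every vertex not in `D` has a neighbor in `D`. -/
def Dominating {V : Type*} (G : SimpleGraph V) (D : Set V) : Prop :=
  ∀ v, v ∉ D → ∃ d ∈ D, G.Adj d v

/-- Dominator wins the S-game on `G` within one move. -/
def WinsWithin1 {V : Type*} (G : SimpleGraph V) : Prop :=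
  ∀ s₁ : V, ∃ d₁, d₁ ≠ s₁ ∧ Dominating G {d₁}

/-- Dominator wins the S-game on `G` within two moves. -/
def WinsWithin2 {V : Type*} (G : SimpleGraph V) : Prop :=
  ∀ s₁ : V, ∃ d₁, d₁ ≠ s₁ ∧
    (Dominating G {d₁} ∨
      ∀ s₂, s₂ ∉ ({s₁, d₁} : Set V) →
        ∃ d₂, d₂ ∉ ({s₁, d₁, s₂} : Set V) ∧ Dominating G {d₁, d₂})

/-- `γ'MB(G) = 2`: Dominator wins the S-game within two moves but not within one. -/
def MBPrimeEqTwo {V : Type*} (G : SimpleGraph V) : Prop :=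
  WinsWithin2 G ∧ ¬ WinsWithin1 G

/-- `G` is `2`-`γ'MB`-critical: `γ'MB(G) = 2` and for every edge `e`, Dominator does not
win the S-game on `G - e` within two moves. -/
def Critical2 {V : Type*} (G : SimpleGraph V) : Prop :=
  MBPrimeEqTwo G ∧ ∀ u v : V, G.Adj u v → ¬ WinsWithin2 (G.deleteEdges {s(u, v)})

/-- The graph `H_m`, the join of `K₂` with the complement of `K_{m-2}`: the first two
vertices are adjacent to everything, the remaining vertices form an independent set.
(`H₀` is the null graph, `H₂ = K₂`.) -/
def HGraph (m : ℕ) : SimpleGraph (Fin m) :=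
  SimpleGraph.fromRel (fun u _ => u.val < 2)

/-- Vertex type of `F_{m₁,t,m₂}`: a copy of `H_{m₁}`, a copy of `H_{m₂}`, the independent
set `B` of `t` vertices, and the two vertices `v₁ = inr (inr 0)` and `v₂ = inr (inr 1)`. -/
abbrev FVert (m₁ t m₂ : ℕ) : Type := (Fin m₁ ⊕ Fin m₂) ⊕ (Fin t ⊕ Fin 2)

/-- The graph `F_{m₁,t,m₂}`: disjoint copies of `H_{m₁}` and `H_{m₂}`, an independent set
`B` of `t` vertices, and nonadjacent vertices `v₁, v₂`, where `v₁` is joined to `H_{m₁}`,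
`v₂` is joined to `H_{m₂}`, and both `v₁` and `v₂` are joined to all of `B`. -/
def FGraph (m₁ t m₂ : ℕ) : SimpleGraph (FVert m₁ t m₂) :=
  SimpleGraph.fromRel (fun u v =>
    match u, v with
    | .inl (.inl a), .inl (.inl _) => a.val < 2   -- inside H_{m₁}
    | .inl (.inr a), .inl (.inr _) => a.val < 2   -- inside H_{m₂}
    | .inr (.inr i), .inl (.inl _) => i = 0       -- v₁ to H_{m₁}
    | .inr (.inr i), .inl (.inr _) => i = 1       -- v₂ to H_{m₂}
    | .inr (.inr _), .inr (.inl _) => True        -- v₁, v₂ to B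
    | _, _ => False)

/-- The conditions on the parameters of `F_{m₁,t,m₂}`. -/
def FCond (m₁ t m₂ : ℕ) : Prop :=
  (m₁ = 0 ∨ 2 ≤ m₁) ∧ m₁ ≤ m₂ ∧ 2 ≤ m₂ ∧ 1 ≤ t ∧ (m₁ = 0 → 2 ≤ t)

/-- Vertex type of `F'_{s,q,m}`: the part `{a, b}` of `K_{2,s}` (`a = inl (inl 0)`,
`b = inl (inl 1)`), the `s`-part of `K_{2,s}`, the `q - 2` vertices `b₁, …, b_{q-2}`,
the vertex `v₁ = inr (inl ())`, the copy of `H_m`, and the vertex `x = inr (inr (inr ()))`. -/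
abbrev F'Vert (s q m : ℕ) : Type :=
  (Fin 2 ⊕ (Fin s ⊕ Fin (q - 2))) ⊕ (Unit ⊕ (Fin m ⊕ Unit))

/-- The graph `F'_{s,q,m}`. -/
def F'Graph (s q m : ℕ) : SimpleGraph (F'Vert s q m) :=
  SimpleGraph.fromRel (fun u v =>
    match u, v with
    | .inl (.inl _), .inl (.inr (.inl _)) => True        -- {a, b} to the s-part
    | .inr (.inl _), .inl _ => True                      -- v₁ to all of P
    | .inr (.inr (.inl h)), .inr (.inr (.inl _)) => h.val < 2  -- inside H_m
    | .inr (.inr (.inr _)), .inr (.inr (.inl _)) => True -- x to H_m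
    | .inr (.inr (.inr _)), .inl (.inl _) => True        -- x to {a, b}
    | .inr (.inr (.inr _)), .inl (.inr (.inr _)) => True -- x to the bᵢ's
    | _, _ => False)

/-- `G` is isomorphic to a member of the family `𝓕 ∪ 𝓕'`. -/
def InFamilyFF' {V : Type*} (G : SimpleGraph V) : Prop :=
  (∃ m₁ t m₂ : ℕ, FCond m₁ t m₂ ∧ Nonempty (G ≃g FGraph m₁ t m₂)) ∨
  (∃ s q m : ℕ, 2 ≤ s ∧ 2 ≤ q ∧ 2 ≤ m ∧ Nonempty (G ≃g F'Graph s q m))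

section

open Set

variable {V : Type*}

theorem dominating_pair_iff (G : SimpleGraph V) (a b : V) :
    Dominating G {a, b} ↔ ∀ z, z = a ∨ z = b ∨ G.Adj a z ∨ G.Adj b z := by
  simp only [Dominating, mem_insert_iff, mem_singleton_iff, exists_eq_or_imp, exists_eq_left]
  exact forall_congr' fun z => by tauto

/-- A *cherry* of `G`: a vertex `d` forming a dominating pair with each of two further
vertices `u` and `w`. -/
def Cherry (G : SimpleGraph V) (d u w : V) : Prop :=
  d ≠ u ∧ d ≠ w ∧ u ≠ w ∧ Dominating G {d, u} ∧ Dominating G {d, w}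

theorem winsWithin2_of_cherry {G : SimpleGraph V}
    (h : ∀ s, ∃ d u w, Cherry G d u w ∧ d ≠ s ∧ u ≠ s ∧ w ≠ s) : WinsWithin2 G := by
  intro s
  obtain ⟨d, u, w, ⟨hdu, hdw, huw, h1, h2⟩, hd, hu, hw⟩ := h s
  refine ⟨d, hd, Or.inr fun s₂ _ => ?_⟩
  by_cases hs : u = s₂
  · exact ⟨w, by simp only [mem_insert_iff, mem_singleton_iff]; grind, h2⟩
  · exact ⟨u, by simp only [mem_insert_iff, mem_singleton_iff]; grind, h1⟩

theorem WinsWithin2.exists_cherry {G : SimpleGraph V} (h : WinsWithin2 G) (s : V)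
    (h₁ : ∀ d, d ≠ s → ∃ z, z ≠ s ∧ z ≠ d)
    (h₂ : ∀ d, d ≠ s → Dominating G {d} → ∃ u w, u ≠ w ∧ u ≠ s ∧ u ≠ d ∧ w ≠ s ∧ w ≠ d) :
    ∃ d u w, Cherry G d u w ∧ d ≠ s ∧ u ≠ s ∧ w ≠ s := by
  obtain ⟨d, hd, hdom | hdom⟩ := h s
  · obtain ⟨u, w, huw, hus, hud, hws, hwd⟩ := h₂ d hd hdom
    have key : ∀ z, Dominating G {d, z} := fun z y hy => by
      obtain ⟨c, hc, hcy⟩ := hdom y fun h => hy (by simp_all)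
      exact ⟨c, by simp_all, hcy⟩
    exact ⟨d, u, w, ⟨hud.symm, hwd.symm, huw, key u, key w⟩, hd, hus, hws⟩
  · simp only [mem_insert_iff, mem_singleton_iff, not_or] at hdom
    obtain ⟨z, hzs, hzd⟩ := h₁ d hd
    obtain ⟨u, ⟨hus, hud, -⟩, hu⟩ := hdom z ⟨hzs, hzd⟩
    obtain ⟨w, ⟨hws, hwd, hwu⟩, hw⟩ := hdom u ⟨hus, hud⟩
    exact ⟨d, u, w, ⟨Ne.symm hud, Ne.symm hwd, Ne.symm hwu, hu, hw⟩, hd, hus, hws⟩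

theorem WinsWithin2.exists_cherry_of_four {G : SimpleGraph V} (h : WinsWithin2 G)
    {a b c d : V} (hne : [a, b, c, d].Nodup) (s : V) :
    ∃ d u w, Cherry G d u w ∧ d ≠ s ∧ u ≠ s ∧ w ≠ s := by
  simp only [List.nodup_cons, List.mem_cons, List.not_mem_nil, or_false, not_or,
    List.nodup_nil, not_false_eq_true, and_true] at hne
  have key : ∀ e, ∃ u w, u ≠ w ∧ u ≠ s ∧ u ≠ e ∧ w ≠ s ∧ w ≠ e := by
    intro e
    by_contra! hcon
    have h1 := hcon a b
    have h2 := hcon a c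
    have h3 := hcon a d
    have h4 := hcon b c
    have h5 := hcon b d
    have h6 := hcon c d
    grind +splitImp
  refine h.exists_cherry s (fun e _ => ?_) fun e _ _ => key e
  obtain ⟨u, -, -, hs, he, -⟩ := key e
  exact ⟨u, hs, he⟩

theorem Dominating.mono {G K : SimpleGraph V} (h : G ≤ K) {D : Set V}
    (hD : Dominating G D) : Dominating K D := fun v hv => by
  obtain ⟨d, hd, hdv⟩ := hD v hv
  exact ⟨d, hd, h hdv⟩

/-- The part played by a vertex in a graph of the families: the vertices `v` and `x`, the hubs
and leaves of the copy of `H_m` attached to `x`, and the hubs, the neighbours of the hubs and the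
remaining vertices on the side of `v`. -/
inductive Role
  | v | x | hubX | leafX | hubV | leafV | mid
  deriving DecidableEq

/-- Adjacency between roles. The flag tells whether the hubs on the side of `v` are joined to `x`
(as in `𝓕'`) or to each other (as in `𝓕`). -/
def Role.arc (m : Bool) : Role → Role → Prop
  | .v, .hubV | .v, .leafV | .v, .mid => True
  | .x, .hubX | .x, .leafX | .x, .mid => True
  | .x, .hubV => m = true
  | .hubX, .hubX | .hubX, .leafX => True
  | .hubV, .hubV => m = false
  | .hubV, .leafV => True
  | _, _ => False

/-- The graph in which adjacency is prescribed by the roles of the vertices. -/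
def roleGraph (m : Bool) (ρ : V → Role) : SimpleGraph V :=
  SimpleGraph.fromRel fun u w => (ρ u).arc m (ρ w)

/-- The multiplicities of the roles that occur in the families. -/
structure IsLabeling (m : Bool) (ρ : V → Role) : Prop where
  card_v : Nat.card {w // ρ w = .v} = 1
  card_x : Nat.card {w // ρ w = .x} = 1
  card_hubX : Nat.card {w // ρ w = .hubX} = 2
  card_hubV : Nat.card {w // ρ w = .hubV} = 2
  card_mid : m = false → Nat.card {w // ρ w = .mid} ≠ 0
  card_leafV : m = true → Nat.card {w // ρ w = .leafV} ≠ 1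

theorem card_role_eq_one_iff {ρ : V → Role} {r : Role} :
    Nat.card {w // ρ w = r} = 1 ↔ ∃ a, ∀ w, ρ w = r ↔ w = a := by
  change Nat.card ({w | ρ w = r} : Set V) = 1 ↔ _
  rw [Nat.card_coe_set_eq, Set.ncard_eq_one]
  simp [Set.ext_iff]

theorem card_role_eq_two_iff {ρ : V → Role} {r : Role} :
    Nat.card {w // ρ w = r} = 2 ↔ ∃ a b, a ≠ b ∧ ∀ w, ρ w = r ↔ w = a ∨ w = b := by
  change Nat.card ({w | ρ w = r} : Set V) = 2 ↔ _
  rw [Nat.card_coe_set_eq, Set.ncard_eq_two]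
  simp [Set.ext_iff]

theorem IsLabeling.winsWithin2 {m : Bool} {ρ : V → Role} (hρ : IsLabeling m ρ)
    {G : SimpleGraph V} (hG : roleGraph m ρ ≤ G) : WinsWithin2 G := by
  obtain ⟨v, hv⟩ := card_role_eq_one_iff.1 hρ.card_v
  obtain ⟨x, hx⟩ := card_role_eq_one_iff.1 hρ.card_x
  obtain ⟨h, h', hh, hX⟩ := card_role_eq_two_iff.1 hρ.card_hubX
  obtain ⟨a, b, hab, hV⟩ := card_role_eq_two_iff.1 hρ.card_hubV
  have r1 := (hv v).2 rfl
  have r2 := (hx x).2 rfl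
  have r3 := (hX h).2 (.inl rfl)
  have r4 := (hX h').2 (.inr rfl)
  have r5 := (hV a).2 (.inl rfl)
  have r6 := (hV b).2 (.inr rfl)
  have dv : ∀ z, ρ z = .hubX → Dominating G {v, z} := fun z hz =>
    Dominating.mono hG <| (dominating_pair_iff _ _ _).2 fun y => by
      have := hv y
      have := hx y
      simp only [roleGraph, SimpleGraph.fromRel_adj, r1, hz]
      rcases hy : ρ y <;> simp [Role.arc] <;> grind
  have dx : ∀ z, ρ z = .hubV → Dominating G {x, z} := fun z hz =>
    Dominating.mono hG <| (dominating_pair_iff _ _ _).2 fun y => by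
      have := hv y
      have := hx y
      simp only [roleGraph, SimpleGraph.fromRel_adj, r2, hz]
      cases m <;> rcases hy : ρ y <;> simp [Role.arc] <;> grind
  refine winsWithin2_of_cherry fun s => ?_
  by_cases hs : s = v ∨ s = h ∨ s = h'
  · exact ⟨x, a, b, ⟨by grind, by grind, hab, dx a r5, dx b r6⟩, by grind, by grind, by grind⟩
  · exact ⟨v, h, h', ⟨by grind, by grind, hh, dv h r3, dv h' r4⟩, by grind, by grind, by grind⟩

theorem IsLabeling.not_winsWithin1 {m : Bool} {ρ : V → Role} (hρ : IsLabeling m ρ) :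
    ¬ WinsWithin1 (roleGraph m ρ) := by
  obtain ⟨v, hv⟩ := card_role_eq_one_iff.1 hρ.card_v
  obtain ⟨x, hx⟩ := card_role_eq_one_iff.1 hρ.card_x
  obtain ⟨h, h', hh, hX⟩ := card_role_eq_two_iff.1 hρ.card_hubX
  have r1 := (hv v).2 rfl
  have r2 := (hx x).2 rfl
  have r3 := (hX h).2 (.inl rfl)
  intro hw
  obtain ⟨d, -, hd⟩ := hw v
  have key : ∀ z, z = d ∨ (ρ d).arc m (ρ z) ∨ (ρ z).arc m (ρ d) := fun z => by
    by_cases hz : z = d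
    · exact .inl hz
    · obtain ⟨c, rfl, hc⟩ := hd z hz
      exact .inr ((SimpleGraph.fromRel_adj _ _ _).1 hc).2
  have k1 := key v
  have k2 := key x
  have k3 := key h
  rw [r1] at k1
  rw [r2] at k2
  rw [r3] at k3
  rcases hd : ρ d <;> simp [hd, Role.arc] at k1 k2 k3 <;> grind

theorem not_two_universal_of_hubs {K : SimpleGraph V} {S : V → Prop} {h h' p q u w : V}
    (hK : ∀ y z, S y → S z → K.Adj y z → y = h ∨ y = h' ∨ z = h ∨ z = h')
    (hp : p = h ∨ p = h') (hSh : S h) (hSh' : S h') (hSq : S q)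
    (hSu : S u) (hSw : S w) (hpq : p ≠ q) (hadj : ¬ K.Adj p q) (huw : u ≠ w)
    (hu : ∀ z, S z → z = u ∨ K.Adj u z) (hw : ∀ z, S z → z = w ∨ K.Adj w z) : False := by
  have h1 := hu p (by grind)
  have h2 := hu q hSq
  have h3 := hw p (by grind)
  have h4 := hw q hSq
  have h5 := hu w hSw
  have h6 := hK u q hSu hSq
  have h7 := hK w q hSw hSq
  have h8 := hK u w hSu hSw
  have h9 := K.adj_comm p q
  grind

/-- Roles on the side of `x`. -/
def Role.SideX (r : Role) : Prop := r = .hubX ∨ r = .leafX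

/-- Roles on the side of `v`. -/
def Role.SideV (r : Role) : Prop := r = .hubV ∨ r = .leafV ∨ r = .mid

theorem Role.sideV_of_arc {m : Bool} {r s : Role} (hr : r = .v) (h : r.arc m s ∨ s.arc m r) :
    s.SideV := by
  subst hr; cases s <;> simp_all [Role.arc, Role.SideV]

theorem Role.sideX_of_arc {m : Bool} {r s : Role} (hr : r.SideX) (h : r.arc m s ∨ s.arc m r) :
    s = .x ∨ s.SideX ∧ (r = .hubX ∨ s = .hubX) := by
  cases r <;> cases s <;> simp_all [Role.arc, Role.SideX]

theorem Role.of_arc_sideV {m : Bool} {r s : Role} (hr : r.SideV) (h : r.arc m s ∨ s.arc m r) :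
    s = .v ∨ s = .x ∨ (r = .hubV ∧ s = .hubV ∧ m = false) ∨ (r = .hubV ∧ s = .leafV) ∨
      (r = .leafV ∧ s = .hubV) := by
  cases r <;> cases s <;> simp_all [Role.arc, Role.SideV]

theorem Role.of_arc_x {m : Bool} {r s : Role} (hr : r = .x) (h : r.arc m s ∨ s.arc m r) :
    s.SideX ∨ s = .mid ∨ s = .hubV ∧ m = true := by
  subst hr; cases s <;> simp_all [Role.arc, Role.SideX]

theorem Role.arc_cases {m : Bool} {r s : Role} (h : r.arc m s) :
    (r = .v ∧ s.SideV) ∨ (r = .x ∧ s.SideX) ∨ (r = .x ∧ s = .mid) ∨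
      (r = .x ∧ s = .hubV ∧ m = true) ∨ (r = .hubX ∧ s.SideX) ∨
      (r = .hubV ∧ s = .hubV ∧ m = false) ∨ (r = .hubV ∧ s = .leafV) := by
  cases r <;> cases s <;> simp_all [Role.arc, Role.SideX, Role.SideV]

theorem Role.SideX.not_sideV {r : Role} (h : r.SideX) : ¬ r.SideV := by
  cases r <;> simp_all [Role.SideX, Role.SideV]

theorem Role.SideX.ne {r : Role} (h : r.SideX) : r ≠ .v ∧ r ≠ .x := by
  cases r <;> simp_all [Role.SideX]

theorem Role.SideV.ne {r : Role} (h : r.SideV) : r ≠ .v ∧ r ≠ .x := by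
  cases r <;> simp_all [Role.SideV]

theorem IsLabeling.exists_ne_leafV {ρ : V → Role} (hρ : IsLabeling true ρ) {w : V}
    (hw : ρ w = .leafV) : ∃ w', w' ≠ w ∧ ρ w' = .leafV := by
  by_contra! hcon
  exact hρ.card_leafV rfl (card_role_eq_one_iff.2 ⟨w, fun z => ⟨fun hz => by grind, by grind⟩⟩)

theorem IsLabeling.exists_mid {ρ : V → Role} (hρ : IsLabeling false ρ) : ∃ w, ρ w = .mid := by
  by_contra! hcon
  have : IsEmpty {w // ρ w = .mid} := ⟨fun w => hcon w.1 w.2⟩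
  exact hρ.card_mid rfl Nat.card_of_isEmpty

/-- No vertex on the side of `v` dominates that side. -/
theorem IsLabeling.not_dominates_sideV {m : Bool} {ρ : V → Role} (hρ : IsLabeling m ρ)
    {K : SimpleGraph V} (hK : K ≤ roleGraph m ρ) {u : V} (hu : (ρ u).SideV)
    (hdom : ∀ z, (ρ z).SideV → z = u ∨ K.Adj u z) : False := by
  obtain ⟨a, b, hab, hV⟩ := card_role_eq_two_iff.1 hρ.card_hubV
  have r5 := (hV a).2 (.inl rfl)
  have r6 := (hV b).2 (.inr rfl)
  have hadj : ∀ z, (ρ z).SideV → z = u ∨ (ρ u = .hubV ∧ ρ z = .hubV ∧ m = false) ∨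
      (ρ u = .hubV ∧ ρ z = .leafV) ∨ (ρ u = .leafV ∧ ρ z = .hubV) := fun z hz => by
    have := hz.ne
    rcases hdom z hz with h | h
    · exact .inl h
    · have := Role.of_arc_sideV hu ((SimpleGraph.fromRel_adj _ _ _).1 (hK h)).2
      grind
  have ha := hadj a (.inl r5)
  have hb := hadj b (.inl r6)
  cases m
  · obtain ⟨c, hc⟩ := hρ.exists_mid
    have := hadj c (.inr (.inr hc))
    grind
  · have key : ρ u = .leafV := by grind
    obtain ⟨c, hcu, hc⟩ := hρ.exists_ne_leafV key
    have := hadj c (.inr (.inl hc))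
    grind

theorem IsLabeling.not_winsWithin2 {m : Bool} {ρ : V → Role} (hρ : IsLabeling m ρ)
    {K : SimpleGraph V} (hK : K ≤ roleGraph m ρ) {p q : V} (hpq : p ≠ q)
    (harc : (ρ p).arc m (ρ q)) (hnot : ¬ K.Adj p q) : ¬ WinsWithin2 K := by
  obtain ⟨v, hv⟩ := card_role_eq_one_iff.1 hρ.card_v
  obtain ⟨x, hx⟩ := card_role_eq_one_iff.1 hρ.card_x
  obtain ⟨h, h', hh, hX⟩ := card_role_eq_two_iff.1 hρ.card_hubX
  obtain ⟨a, b, hab, hV⟩ := card_role_eq_two_iff.1 hρ.card_hubV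
  have r1 := (hv v).2 rfl
  have r2 := (hx x).2 rfl
  have r3 := (hX h).2 (.inl rfl)
  have r4 := (hX h').2 (.inr rfl)
  have r5 := (hV a).2 (.inl rfl)
  have r6 := (hV b).2 (.inr rfl)
  have hadj : ∀ {y z}, K.Adj y z → (ρ y).arc m (ρ z) ∨ (ρ z).arc m (ρ y) := fun hyz =>
    ((SimpleGraph.fromRel_adj _ _ _).1 (hK hyz)).2
  have hsymm := fun y z => K.adj_comm y z
  have hv_adj : ∀ z, K.Adj v z → (ρ z).SideV := fun z hz => Role.sideV_of_arc r1 (hadj hz)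
  have hx_adj : ∀ z, K.Adj x z → (ρ z).SideX ∨ ρ z = .mid ∨ ρ z = .hubV ∧ m = true :=
    fun z hz => Role.of_arc_x r2 (hadj hz)
  have hX_adj : ∀ y z, (ρ y).SideX → K.Adj y z →
      z = x ∨ (ρ z).SideX ∧ (ρ y = .hubX ∨ ρ z = .hubX) := fun y z hy hz => by
    have := Role.sideX_of_arc hy (hadj hz)
    have := hx z
    grind
  have hV_adj : ∀ y z, (ρ y).SideV → K.Adj y z → z = v ∨ z = x ∨
      (ρ y = .hubV ∧ ρ z = .hubV ∧ m = false) ∨ (ρ y = .hubV ∧ ρ z = .leafV) ∨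
      (ρ y = .leafV ∧ ρ z = .hubV) := fun y z hy hz => by
    have := Role.of_arc_sideV hy (hadj hz)
    have := hx z
    have := hv z
    grind
  have hsX : (ρ h).SideX := .inl r3
  have hXV : ∀ y, (ρ y).SideX → ¬ (ρ y).SideV := fun y hy => hy.not_sideV
  have hXne : ∀ y, (ρ y).SideX → y ≠ v ∧ y ≠ x := fun y hy => by
    have := hy.ne
    grind
  have hVne : ∀ y, (ρ y).SideV → y ≠ v ∧ y ≠ x := fun y hy => by
    have := hy.ne
    grind
  intro hwin
  have hcherry := hwin.exists_cherry_of_four (a := v) (b := x) (c := h) (d := h')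
    (by simp; grind)
  have hcover : ∀ y z, Dominating K {y, z} → y = v ∨ y = x ∨ z = v ∨ z = x := by
    intro y z hyz
    rw [dominating_pair_iff] at hyz
    by_contra! hcon
    have d1 := hyz h
    have d2 := hyz v
    have := hX_adj h y hsX
    have := hX_adj h z hsX
    have := hv_adj y
    have := hv_adj z
    have : (ρ y).SideX ∧ (ρ z).SideV ∨ (ρ z).SideX ∧ (ρ y).SideV := by grind
    rcases this with ⟨hy, hz⟩ | ⟨hz, hy⟩
    · refine hρ.not_dominates_sideV hK hz fun t ht => ?_
      have := hyz t
      have := hX_adj y t hy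
      grind
    · refine hρ.not_dominates_sideV hK hy fun t ht => ?_
      have := hyz t
      have := hX_adj z t hz
      grind
  have hstar : ∀ s t, (∀ y z, Dominating K {y, z} → y = s ∨ y = t ∨ z = s ∨ z = t) →
      ∃ u w, u ≠ w ∧ u ≠ s ∧ w ≠ s ∧ u ≠ t ∧ w ≠ t ∧
        Dominating K {t, u} ∧ Dominating K {t, w} := by
    intro s t hst
    obtain ⟨d, u, w, ⟨hdu, hdw, huw, h1, h2⟩, hd, hu, hw⟩ := hcherry s
    have h3 := hst _ _ h1
    have h4 := hst _ _ h2
    have : d = t := by grind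
    subst this
    exact ⟨u, w, huw, hu, hw, hdu.symm, hdw.symm, h1, h2⟩
  obtain ⟨u, w, huw, hux, hwx, huv, hwv, hu, hw⟩ := hstar x v (by grind)
  obtain ⟨u', w', huw', huv', hwv', hux', hwx', hu', hw'⟩ := hstar v x (by grind)
  rw [dominating_pair_iff] at hu hw hu' hw'
  have side_u : ∀ u, u ≠ x → (∀ z, z = v ∨ z = u ∨ K.Adj v z ∨ K.Adj u z) →
      (ρ u).SideX := fun u hux hu => by
    have := hu h
    have := hv_adj h
    have := hX_adj h u hsX
    grind
  have side_u' : ∀ u, u ≠ v → (∀ z, z = x ∨ z = u ∨ K.Adj x z ∨ K.Adj u z) →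
      (ρ u).SideV := fun u huv hu => by
    have := hu v
    have := hx_adj v
    have := hv_adj u
    grind
  have su := side_u u hux hu
  have sw := side_u w hwx hw
  have su' := side_u' u' huv' hu'
  have sw' := side_u' w' hwv' hw'
  have notleaf : ∀ u, (ρ u).SideV → (∀ z, z = x ∨ z = u ∨ K.Adj x z ∨ K.Adj u z) →
      m = true → ρ u ≠ .leafV := fun u hs hu hm hl => by
    subst hm
    obtain ⟨c, hcu, hc⟩ := hρ.exists_ne_leafV hl
    have := hu c
    have := hx_adj c
    have := hV_adj u c hs
    have := hXV c
    have : (ρ c).SideV := .inr (.inl hc)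
    grind
  have hubs_false : m = false → (ρ q = .hubV ∨ ρ q = .leafV) → ρ p = .hubV → False := by
    intro hm hq hp
    have notmid : ∀ u, (ρ u).SideV → (∀ z, z = x ∨ z = u ∨ K.Adj x z ∨ K.Adj u z) →
        ρ u = .hubV ∨ ρ u = .leafV := fun u hs hu => by
      have := hu a
      have := hx_adj a
      have := hV_adj u a hs
      have := hXV a
      have : (ρ a).SideV := .inl r5
      grind
    have hSV : ∀ y, ρ y = .hubV ∨ ρ y = .leafV → (ρ y).SideV := fun y hy => by
      rcases hy with hy | hy <;> simp [hy, Role.SideV]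
    refine not_two_universal_of_hubs (S := fun y => ρ y = .hubV ∨ ρ y = .leafV) (h := a) (h' := b)
      (fun y z hy hz hyz => by
        have := hV_adj y z (hSV y hy) hyz
        have := hVne z (hSV z hz)
        grind) ((hV p).1 hp) (.inl r5) (.inl r6) hq (notmid u' su' hu') (notmid w' sw' hw')
      hpq hnot huw' (fun z hz => ?_) (fun z hz => ?_)
    · have := hu' z
      have := hx_adj z
      have := hXV z
      have := hSV z hz
      grind
    · have := hw' z
      have := hx_adj z
      have := hXV z
      have := hSV z hz
      grind
  rcases Role.arc_cases harc with
    ⟨hp, hq⟩ | ⟨hp, hq⟩ | ⟨hp, hq⟩ | ⟨hp, hq, hm⟩ | ⟨hp, hq⟩ | ⟨hp, hq, hm⟩ | ⟨hp, hq⟩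
  · have := hu q
    have := hX_adj u q su
    grind
  · have := hu' q
    have := hX_adj q u' hq
    grind
  · have h1 := hu' q
    have h2 := hw' q
    have := hV_adj u' q su'
    have := hV_adj w' q sw'
    grind
  · subst hm
    have h1 := notleaf u' su' hu' rfl
    have h2 := notleaf w' sw' hw' rfl
    have h3 := hu' q
    have h4 := hw' q
    have := hV_adj u' q su'
    have := hV_adj w' q sw'
    grind
  · have := (hX p).1 hp
    exact not_two_universal_of_hubs (S := fun y => (ρ y).SideX) (h := h) (h' := h')
      (fun y z hy hz hyz => by have := hX_adj y z hy hyz; grind) this hsX (.inl r4)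
      hq su sw hpq hnot huw
      (fun z hz => by have := hu z; have := hv_adj z; grind)
      (fun z hz => by have := hw z; have := hv_adj z; grind)
  · exact hubs_false hm (.inl hq) hp
  · cases m
    · exact hubs_false rfl (.inr hq) hp
    · have h1 := notleaf u' su' hu' rfl
      have h2 := notleaf w' sw' hw' rfl
      have h3 := hu' q
      have h4 := hw' q
      have := hV_adj u' q su'
      have := hV_adj w' q sw'
      have : (ρ q).SideV := .inr (.inl hq)
      have := hXV q
      have := hVne q
      clear hstar hcover hcherry side_u side_u' notleaf hubs_false hX_adj hadj hw hu
      have := hV p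
      have := hV u'
      have := hV w'
      have := hx_adj q
      grind

theorem IsLabeling.critical2 {m : Bool} {ρ : V → Role} (hρ : IsLabeling m ρ) :
    Critical2 (roleGraph m ρ) := by
  refine ⟨⟨hρ.winsWithin2 le_rfl, hρ.not_winsWithin1⟩, fun u w huw => ?_⟩
  obtain ⟨hne, h | h⟩ := (SimpleGraph.fromRel_adj _ _ _).1 huw
  · exact hρ.not_winsWithin2 (SimpleGraph.deleteEdges_le _) hne h (by simp)
  · exact hρ.not_winsWithin2 (SimpleGraph.deleteEdges_le _) hne.symm h (by simp [Sym2.eq_swap])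

theorem Critical2.eq_roleGraph {G : SimpleGraph V} (hG : Critical2 G) {m : Bool} {ρ : V → Role}
    (hρ : IsLabeling m ρ) (hle : roleGraph m ρ ≤ G) : G = roleGraph m ρ := by
  refine le_antisymm (fun u w huw => ?_) hle
  by_contra hnot
  refine hG.2 u w huw (hρ.winsWithin2 fun y z hyz => ?_)
  rw [SimpleGraph.deleteEdges_adj]
  refine ⟨hle hyz, fun heq => hnot ?_⟩
  rw [Set.mem_singleton_iff] at heq
  rwa [← SimpleGraph.mem_edgeSet, ← heq]

theorem nonempty_iso_roleGraph {W : Type*} [Finite V] [Finite W] (m : Bool) {ρ : V → Role}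
    {σ : W → Role} (h : ∀ r, Nat.card {w // ρ w = r} = Nat.card {w // σ w = r}) :
    Nonempty (roleGraph m ρ ≃g roleGraph m σ) := by
  obtain ⟨e, he⟩ : ∃ e : V ≃ W, ∀ w, σ (e w) = ρ w :=
    ⟨_, Equiv.ofFiberEquiv_map fun r => (Finite.card_eq.1 (h r)).some⟩
  exact ⟨⟨e, fun {a b} => by simp [roleGraph, SimpleGraph.fromRel_adj, he]⟩⟩

theorem IsLabeling.comp_equiv {W : Type*} {m : Bool} {σ : W → Role} (hσ : IsLabeling m σ)
    (e : V ≃ W) : IsLabeling m (σ ∘ e) := by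
  have key : ∀ r, Nat.card {w // (σ ∘ e) w = r} = Nat.card {w // σ w = r} := fun r =>
    Nat.card_congr (e.subtypeEquiv fun _ => Iff.rfl)
  constructor <;> simp only [key]
  exacts [hσ.card_v, hσ.card_x, hσ.card_hubX, hσ.card_hubV, hσ.card_mid, hσ.card_leafV]

theorem IsLabeling.critical2_of_iso {W : Type*} {m : Bool} {σ : W → Role} (hσ : IsLabeling m σ)
    {G : SimpleGraph V} (e : G ≃g roleGraph m σ) : Critical2 G := by
  have : G = roleGraph m (σ ∘ e.toEquiv) := by
    ext u w
    rw [← e.map_adj_iff]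
    simp only [roleGraph, SimpleGraph.fromRel_adj]
    exact and_congr e.injective.ne_iff Iff.rfl
  rw [this]
  exact (hσ.comp_equiv e.toEquiv).critical2

theorem card_role_sum {α β : Type*} [Finite α] [Finite β] (f : α ⊕ β → Role) (r : Role) :
    Nat.card {w // f w = r} =
      Nat.card {a // f (.inl a) = r} + Nat.card {b // f (.inr b) = r} := by
  rw [Nat.card_congr Equiv.subtypeSum, Nat.card_sum]

theorem card_role_const {α : Type*} (p r : Role) :
    Nat.card {_a : α // p = r} = if p = r then Nat.card α else 0 := by
  split_ifs with h
  · exact Nat.card_congr (Equiv.subtypeUnivEquiv fun _ => h)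
  · have : IsEmpty {_a : α // p = r} := ⟨fun a => h a.2⟩
    exact Nat.card_of_isEmpty

theorem card_role_ite (k : ℕ) (p q r : Role) :
    Nat.card {i : Fin (k + 2) // (if i.val < 2 then p else q) = r} =
      (if p = r then 2 else 0) + if q = r then k else 0 := by
  rw [Nat.card_eq_fintype_card, Fintype.card_subtype, Finset.card_filter, Fin.sum_univ_succ,
    Fin.sum_univ_succ]
  simp
  split_ifs <;> omega

theorem card_role_fin_two (p q r : Role) :
    Nat.card {i : Fin 2 // (if i = 0 then p else q) = r} =
      (if p = r then 1 else 0) + if q = r then 1 else 0 := by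
  rw [Nat.card_eq_fintype_card, Fintype.card_subtype, Finset.card_filter, Fin.sum_univ_two]
  simp

/-- The roles of the vertices of `F_{m₁,t,m₂}` with `m₁ ≥ 2`. -/
def roleF (k₁ t k₂ : ℕ) : FVert (k₁ + 2) t (k₂ + 2) → Role
  | .inl (.inl a) => if a.val < 2 then .hubV else .leafV
  | .inl (.inr a) => if a.val < 2 then .hubX else .leafX
  | .inr (.inl _) => .mid
  | .inr (.inr i) => if i = 0 then .v else .x

/-- The roles of the vertices of `F_{0,t,m₂}`. -/
def roleFZero (t k₂ : ℕ) : FVert 0 (t + 2) (k₂ + 2) → Role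
  | .inl (.inl _) => .leafV
  | .inl (.inr a) => if a.val < 2 then .hubX else .leafX
  | .inr (.inl b) => if b.val < 2 then .hubV else .mid
  | .inr (.inr i) => if i = 0 then .v else .x

/-- The roles of the vertices of `F'_{s,q,m}`. -/
def roleF' (s q k : ℕ) : F'Vert s (q + 2) (k + 2) → Role
  | .inl (.inl _) => .hubV
  | .inl (.inr (.inl _)) => .leafV
  | .inl (.inr (.inr _)) => .mid
  | .inr (.inl _) => .v
  | .inr (.inr (.inl a)) => if a.val < 2 then .hubX else .leafX
  | .inr (.inr (.inr _)) => .x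

theorem card_roleF (k₁ t k₂ : ℕ) (r : Role) : Nat.card {w // roleF k₁ t k₂ w = r} =
    match r with
    | .v => 1 | .x => 1 | .hubX => 2 | .leafX => k₂ | .hubV => 2 | .leafV => k₁ | .mid => t := by
  simp only [card_role_sum, roleF, card_role_ite, card_role_const, card_role_fin_two]
  cases r <;> simp

theorem card_roleFZero (t k₂ : ℕ) (r : Role) : Nat.card {w // roleFZero t k₂ w = r} =
    match r with
    | .v => 1 | .x => 1 | .hubX => 2 | .leafX => k₂ | .hubV => 2 | .leafV => 0 | .mid => t := by
  simp only [card_role_sum, roleFZero, card_role_ite, card_role_const, card_role_fin_two]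
  cases r <;> simp

theorem card_roleF' (s q k : ℕ) (r : Role) : Nat.card {w // roleF' s q k w = r} =
    match r with
    | .v => 1 | .x => 1 | .hubX => 2 | .leafX => k | .hubV => 2 | .leafV => s | .mid => q := by
  simp only [card_role_sum, roleF', card_role_ite, card_role_const]
  cases r <;> simp

theorem FGraph_eq_roleGraph (k₁ t k₂ : ℕ) :
    FGraph (k₁ + 2) t (k₂ + 2) = roleGraph false (roleF k₁ t k₂) := by
  ext u w
  rw [FGraph, roleGraph, SimpleGraph.fromRel_adj, SimpleGraph.fromRel_adj]
  refine and_congr_right fun _ => ?_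
  rcases u with (a | a) | (a | a) <;> rcases w with (b | b) | (b | b) <;>
    simp only [roleF] <;> (try split_ifs) <;> simp_all [Role.arc] <;> omega

theorem FGraph_zero_eq_roleGraph (t k₂ : ℕ) :
    FGraph 0 (t + 2) (k₂ + 2) = roleGraph true (roleFZero t k₂) := by
  ext u w
  rw [FGraph, roleGraph, SimpleGraph.fromRel_adj, SimpleGraph.fromRel_adj]
  refine and_congr_right fun _ => ?_
  rcases u with (a | a) | (a | a) <;> rcases w with (b | b) | (b | b) <;>
    first
    | exact a.elim0
    | exact b.elim0
    | (simp only [roleFZero]; (try split_ifs) <;> simp_all [Role.arc] <;> omega)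

theorem F'Graph_eq_roleGraph (s q k : ℕ) :
    F'Graph s (q + 2) (k + 2) = roleGraph true (roleF' s q k) := by
  ext u w
  rw [F'Graph, roleGraph, SimpleGraph.fromRel_adj, SimpleGraph.fromRel_adj]
  refine and_congr_right fun _ => ?_
  rcases u with (a | a | a) | (a | a | a) <;> rcases w with (b | b | b) | (b | b | b) <;>
    simp only [roleF'] <;> (try split_ifs) <;> simp_all [Role.arc]

theorem InFamilyFF'.critical2 {G : SimpleGraph V} (h : InFamilyFF' G) : Critical2 G := by
  rcases h with ⟨m₁, t, m₂, ⟨h1, h2, h3, h4, h5⟩, ⟨e⟩⟩ | ⟨s, q, m, hs, hq, hm, ⟨e⟩⟩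
  · obtain ⟨k₂, rfl⟩ := Nat.exists_eq_add_of_le' h3
    rcases h1 with rfl | h1
    · obtain ⟨k, rfl⟩ := Nat.exists_eq_add_of_le' (h5 rfl)
      rw [FGraph_zero_eq_roleGraph] at e
      refine IsLabeling.critical2_of_iso ?_ e
      constructor <;> simp only [card_roleFZero] <;> simp
    · obtain ⟨k₁, rfl⟩ := Nat.exists_eq_add_of_le' h1
      rw [FGraph_eq_roleGraph] at e
      refine IsLabeling.critical2_of_iso ?_ e
      constructor <;> simp only [card_roleF] <;> simp
      omega
  · obtain ⟨k, rfl⟩ := Nat.exists_eq_add_of_le' hm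
    obtain ⟨l, rfl⟩ := Nat.exists_eq_add_of_le' hq
    rw [F'Graph_eq_roleGraph] at e
    refine IsLabeling.critical2_of_iso ?_ e
    constructor <;> simp only [card_roleF'] <;> simp
    omega

/-- Exchange of the two sides. -/
def Role.swap : Role → Role
  | .v => .x | .x => .v | .hubX => .hubV | .leafX => .leafV | .hubV => .hubX | .leafV => .leafX
  | .mid => .mid

theorem roleGraph_swap (ρ : V → Role) :
    roleGraph false (fun w => (ρ w).swap) = roleGraph false ρ := by
  ext u w
  simp only [roleGraph, SimpleGraph.fromRel_adj]
  cases ρ u <;> cases ρ w <;> simp [Role.swap, Role.arc]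

theorem card_role_swap (ρ : V → Role) (r : Role) :
    Nat.card {w // (ρ w).swap = r} = Nat.card {w // ρ w = r.swap} := by
  refine Nat.card_congr (Equiv.subtypeEquivRight fun w => ?_)
  cases ρ w <;> cases r <;> simp [Role.swap]

theorem IsLabeling.swap {ρ : V → Role} (hρ : IsLabeling false ρ) :
    IsLabeling false fun w => (ρ w).swap := by
  constructor <;> simp only [card_role_swap]
  exacts [hρ.card_x, hρ.card_v, hρ.card_hubV, hρ.card_hubX, fun _ => hρ.card_mid rfl, by simp]

theorem IsLabeling.inFamilyFF'_of_le [Finite V] {ρ : V → Role} (hρ : IsLabeling false ρ)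
    (hle : Nat.card {w // ρ w = Role.leafV} ≤ Nat.card {w // ρ w = Role.leafX}) :
    InFamilyFF' (roleGraph false ρ) := by
  have h0 := hρ.card_mid rfl
  refine .inl ⟨Nat.card {w // ρ w = Role.leafV} + 2, Nat.card {w // ρ w = Role.mid},
    Nat.card {w // ρ w = Role.leafX} + 2, ⟨by omega, by omega, by omega, by omega, by omega⟩, ?_⟩
  rw [FGraph_eq_roleGraph]
  refine nonempty_iso_roleGraph false fun r => ?_
  rw [card_roleF]
  cases r
  exacts [hρ.card_v, hρ.card_x, hρ.card_hubX, rfl, hρ.card_hubV, rfl, rfl]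

theorem IsLabeling.inFamilyFF' [Finite V] {m : Bool} {ρ : V → Role} (hρ : IsLabeling m ρ) :
    InFamilyFF' (roleGraph m ρ) := by
  cases m
  · rcases le_total (Nat.card {w // ρ w = Role.leafV}) (Nat.card {w // ρ w = Role.leafX}) with h | h
    · exact hρ.inFamilyFF'_of_le h
    · rw [← roleGraph_swap]
      exact hρ.swap.inFamilyFF'_of_le (by rw [card_role_swap, card_role_swap]; exact h)
  · by_cases h0 : Nat.card {w // ρ w = Role.leafV} = 0
    · refine .inl ⟨0, Nat.card {w // ρ w = Role.mid} + 2, Nat.card {w // ρ w = Role.leafX} + 2,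
        ⟨by omega, by omega, by omega, by omega, by omega⟩, ?_⟩
      rw [FGraph_zero_eq_roleGraph]
      refine nonempty_iso_roleGraph true fun r => ?_
      rw [card_roleFZero]
      cases r
      exacts [hρ.card_v, hρ.card_x, hρ.card_hubX, rfl, hρ.card_hubV, h0, rfl]
    · have h1 := hρ.card_leafV rfl
      refine .inr ⟨Nat.card {w // ρ w = Role.leafV}, Nat.card {w // ρ w = Role.mid} + 2,
        Nat.card {w // ρ w = Role.leafX} + 2, by omega, by omega, by omega, ?_⟩
      rw [F'Graph_eq_roleGraph]
      refine nonempty_iso_roleGraph true fun r => ?_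
      rw [card_roleF']
      cases r
      exacts [hρ.card_v, hρ.card_x, hρ.card_hubX, rfl, hρ.card_hubV, rfl, rfl]

/-- The vertex `d` is equal or adjacent to every vertex of `A`. -/
def UniversalIn (G : SimpleGraph V) (A : Set V) (d : V) : Prop :=
  ∀ z ∈ A, z = d ∨ G.Adj d z

theorem not_critical2_of_universalIn {G : SimpleGraph V} (hconn : G.Connected) {A : Set V}
    {a b h k : V} (ha : a ∈ A) (hb : b ∈ A) (hab : a ≠ b) (hh : h ∉ A) (hk : k ∉ A) (hhk : h ≠ k)
    (ua : UniversalIn G A a) (ub : UniversalIn G A b) (uh : UniversalIn G Aᶜ h)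
    (uk : UniversalIn G Aᶜ k) : ¬ Critical2 G := by
  intro hG
  obtain ⟨w⟩ := hconn.preconnected a h
  obtain ⟨d, -, hd1, hd2⟩ := w.exists_boundary_dart A ha hh
  refine hG.2 _ _ d.adj (winsWithin2_of_cherry ?_)
  set K := G.deleteEdges {s(d.fst, d.snd)} with hK
  have key : ∀ p ∈ A, UniversalIn G A p → ∀ q, q ∉ A → UniversalIn G Aᶜ q →
      Dominating K {p, q} ∧ Dominating K {q, p} := by
    intro p hp up q hq uq
    simp only [dominating_pair_iff, hK, SimpleGraph.deleteEdges_adj, mem_singleton_iff,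
      Sym2.eq_iff]
    have hA := fun z => up z
    have hC := fun z => uq z
    simp only [mem_compl_iff] at hC
    constructor <;> intro z <;> have h1 := hA z <;> have h2 := hC z <;> clear hA hC <;> grind
  have c1 : Cherry K a h k := ⟨by grind, by grind, hhk, (key a ha ua h hh uh).1,
    (key a ha ua k hk uk).1⟩
  have c2 : Cherry K b h k := ⟨by grind, by grind, hhk, (key b hb ub h hh uh).1,
    (key b hb ub k hk uk).1⟩
  have c3 : Cherry K h a b := ⟨by grind, by grind, hab, (key a ha ua h hh uh).2,
    (key b hb ub h hh uh).2⟩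
  have c4 : Cherry K k a b := ⟨by grind, by grind, hab, (key a ha ua k hk uk).2,
    (key b hb ub k hk uk).2⟩
  intro s
  by_cases hsA : s ∈ A
  · by_cases hs : s = a
    · exact ⟨b, h, k, c2, by grind, by grind, by grind⟩
    · exact ⟨a, h, k, c1, by grind, by grind, by grind⟩
  · by_cases hs : s = h
    · exact ⟨k, a, b, c4, by grind, by grind, by grind⟩
    · exact ⟨h, a, b, c3, by grind, by grind, by grind⟩

theorem Critical2.inFamilyFF'_of_partition [Finite V] {G : SimpleGraph V} (hG : Critical2 G)
    (m : Bool) {v x h k a b : V} {X L : Set V} (hne : [v, x, h, k, a, b].Nodup)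
    (hX : ∀ w ∈ X, w ∉ [v, x, h, k, a, b]) (hL : ∀ w ∈ L, w ∉ [v, x, h, k, a, b] ∧ w ∉ X)
    (hM : ∀ w, w ∉ [v, x, h, k, a, b] → w ∉ X → w ∉ L → G.Adj v w ∧ G.Adj x w)
    (hm : m = false → G.Adj a b ∧ ∃ w, w ∉ [v, x, h, k, a, b] ∧ w ∉ X ∧ w ∉ L)
    (hm' : m = true → G.Adj x a ∧ G.Adj x b ∧ ∀ r ∈ L, ∃ r' ∈ L, r ≠ r')
    (hva : G.Adj v a) (hvb : G.Adj v b) (hxh : G.Adj x h) (hxk : G.Adj x k) (hhk : G.Adj h k)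
    (hLv : ∀ w ∈ L, G.Adj v w ∧ G.Adj a w ∧ G.Adj b w)
    (hXx : ∀ w ∈ X, G.Adj x w ∧ G.Adj h w ∧ G.Adj k w) : InFamilyFF' G := by
  simp only [List.nodup_cons, List.mem_cons, List.not_mem_nil, or_false, not_or,
    List.nodup_nil, not_false_eq_true, and_true] at hne hX hL hM hm
  classical
  let ρ : V → Role := fun w => if w = v then .v else if w = x then .x else
    if w = h ∨ w = k then .hubX else if w = a ∨ w = b then .hubV else if w ∈ X then .leafX else
    if w ∈ L then .leafV else .mid
  have rv : ∀ w, ρ w = .v ↔ w = v := fun w => by grind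
  have rx : ∀ w, ρ w = .x ↔ w = x := fun w => by grind
  have rh : ∀ w, ρ w = .hubX ↔ w = h ∨ w = k := fun w => by grind
  have ra : ∀ w, ρ w = .hubV ↔ w = a ∨ w = b := fun w => by grind
  have rX : ∀ w, ρ w = .leafX ↔ w ∈ X := fun w => by have := hX w; grind
  have rL : ∀ w, ρ w = .leafV ↔ w ∈ L := fun w => by have := hL w; grind
  have rM : ∀ w, ρ w = .mid ↔ (¬w = v ∧ ¬w = x ∧ ¬w = h ∧ ¬w = k ∧ ¬w = a ∧ ¬w = b) ∧
    w ∉ X ∧ w ∉ L := fun w => by grind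
  clear_value ρ
  have hρ : IsLabeling m ρ := by
    refine ⟨card_role_eq_one_iff.2 ⟨v, rv⟩, card_role_eq_one_iff.2 ⟨x, rx⟩,
      card_role_eq_two_iff.2 ⟨h, k, by grind, rh⟩, card_role_eq_two_iff.2 ⟨a, b, by grind, ra⟩,
      fun hm0 => ?_, fun hm0 h1 => ?_⟩
    · obtain ⟨-, w, hw⟩ := hm hm0
      have : Nonempty {w // ρ w = Role.mid} := ⟨w, (rM w).2 hw⟩
      exact Nat.card_pos.ne'
    · obtain ⟨r, hr⟩ := card_role_eq_one_iff.1 h1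
      obtain ⟨r', hr', hrr⟩ := (hm' hm0).2.2 r ((rL r).1 ((hr r).2 rfl))
      exact hrr ((hr r').1 ((rL r').2 hr')).symm
  have hle : roleGraph m ρ ≤ G := by
    have key : ∀ y z, (ρ y).arc m (ρ z) → y ≠ z → G.Adj y z := by
      intro y z hyz hne'
      have z1 := hM z
      have z2 := hLv z
      have z3 := hXx z
      have hab' := G.adj_comm a b
      have hhk' := G.adj_comm h k
      have y1 := rv y
      have y2 := rx y
      have y3 := rh y
      have y4 := ra y
      have w3 := rh z
      have w4 := ra z
      have w5 := rX z
      have w6 := rL z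
      have w7 := rM z
      clear hX hL hM hLv hXx hρ rv rx rh ra rX rL rM hne
      rcases hy : ρ y <;> rcases hz : ρ z <;> rw [hy, hz] at hyz <;>
        simp only [Role.arc] at hyz <;> simp only [hy, hz, true_iff] at * <;> grind
    intro y z hyz
    obtain ⟨hne', h1 | h1⟩ := (SimpleGraph.fromRel_adj _ _ _).1 hyz
    · exact key _ _ h1 hne'
    · exact (key _ _ h1 hne'.symm).symm
  rw [hG.eq_roleGraph hρ hle]
  exact hρ.inFamilyFF'

/-- Removing the vertex `x` leaves no edges between the nonempty sets `A` and `C`, which cover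
the remaining vertices. -/
structure IsCut (G : SimpleGraph V) (x : V) (A C : Set V) : Prop where
  left_nonempty : A.Nonempty
  right_nonempty : C.Nonempty
  notMem_left : x ∉ A
  notMem_right : x ∉ C
  cover : ∀ z, z = x ∨ z ∈ A ∨ z ∈ C
  notMem_of_mem : ∀ z ∈ A, z ∉ C
  not_adj : ∀ a ∈ A, ∀ c ∈ C, ¬ G.Adj a c

theorem IsCut.symm {G : SimpleGraph V} {x : V} {A C : Set V} (h : IsCut G x A C) :
    IsCut G x C A :=
  ⟨h.right_nonempty, h.left_nonempty, h.notMem_right, h.notMem_left,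
    fun z => (h.cover z).imp_right Or.symm,
    fun z hz hz' => h.notMem_of_mem z hz' hz, fun c hc a ha hca => h.not_adj a ha c hc hca.symm⟩

theorem IsCut.compl_left {G : SimpleGraph V} {x : V} {A C : Set V} (h : IsCut G x A C) :
    Aᶜ = insert x C := by
  ext z
  have := h.cover z
  have := h.notMem_of_mem z
  have := h.notMem_left
  simp only [mem_compl_iff, mem_insert_iff]
  grind

theorem IsCut.exists_of_not_connected {G : SimpleGraph V} {x y : V} (hy : y ≠ x)
    (h : ¬ (G.induce ({x}ᶜ : Set V)).Connected) : ∃ A C, IsCut G x A C := by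
  have : Nonempty ({x}ᶜ : Set V) := ⟨y, hy⟩
  have h' : ¬ (G.induce ({x}ᶜ : Set V)).Preconnected := fun hp => h ⟨hp⟩
  simp only [SimpleGraph.Preconnected, not_forall] at h'
  obtain ⟨u, v, huv⟩ := h'
  refine ⟨{w | ∃ hw : w ≠ x, (G.induce ({x}ᶜ : Set V)).Reachable u ⟨w, hw⟩},
    {w | ∃ hw : w ≠ x, ¬ (G.induce ({x}ᶜ : Set V)).Reachable u ⟨w, hw⟩},
    ⟨u, u.2, .refl _⟩, ⟨v, v.2, huv⟩, by simp, by simp, ?_, ?_, ?_⟩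
  · intro z
    by_cases hz : z = x
    · exact .inl hz
    · by_cases hr : (G.induce ({x}ᶜ : Set V)).Reachable u ⟨z, hz⟩
      · exact .inr (.inl ⟨hz, hr⟩)
      · exact .inr (.inr ⟨hz, hr⟩)
  · rintro z ⟨_, hz⟩ ⟨_, hz'⟩
    exact hz' hz
  · rintro a ⟨ha, har⟩ c ⟨hc, hcr⟩ hac
    refine hcr (har.trans (SimpleGraph.Adj.reachable ?_))
    exact hac

theorem IsCut.mem_of_dominating {G : SimpleGraph V} {x : V} {A C : Set V} (h : IsCut G x A C)
    {p q : V} (hp : p ≠ x) (hq : q ≠ x) (hpq : Dominating G {p, q}) :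
    p ∈ A ∧ q ∈ C ∨ p ∈ C ∧ q ∈ A := by
  rw [dominating_pair_iff] at hpq
  obtain ⟨a, ha⟩ := h.left_nonempty
  obtain ⟨c, hc⟩ := h.right_nonempty
  have h1 := hpq a
  have h2 := hpq c
  have h3 := h.cover p
  have h4 := h.cover q
  have h5 := h.notMem_of_mem
  have h6 := fun b hb => h.not_adj b hb c hc
  have h7 := fun b hb hab => h.not_adj a ha b hb (SimpleGraph.Adj.symm hab)
  clear hpq h
  grind

theorem IsCut.universalIn_of_dominating {G : SimpleGraph V} {x : V} {A C : Set V}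
    (h : IsCut G x A C) {p q : V} (hp : p ∈ A) (hq : q ∈ C) (hpq : Dominating G {p, q}) :
    UniversalIn G A p ∧ UniversalIn G C q ∧ (G.Adj p x ∨ G.Adj q x) := by
  rw [dominating_pair_iff] at hpq
  refine ⟨fun z hz => ?_, fun z hz => ?_, ?_⟩
  · have h1 := hpq z
    have h2 := fun hqz => h.not_adj z hz q hq (SimpleGraph.Adj.symm hqz)
    have h3 := h.notMem_of_mem z hz
    grind
  · have h1 := hpq z
    have h2 := h.not_adj p hp z hz
    have h3 := h.notMem_of_mem p hp
    grind
  · have h1 := hpq x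
    have h2 := h.notMem_left
    have h3 := h.notMem_right
    grind

theorem IsCut.adj_of_dominating {G : SimpleGraph V} {x : V} {A C : Set V}
    (h : IsCut G x A C) {q : V} (hq : q ∈ C) (hpq : Dominating G {x, q}) :
    ∀ z ∈ A, G.Adj x z := by
  rw [dominating_pair_iff] at hpq
  intro z hz
  have h1 := hpq z
  have h2 := fun hqz => h.not_adj z hz q hq (SimpleGraph.Adj.symm hqz)
  have h3 := h.notMem_of_mem z hz
  have h4 := h.notMem_left
  grind

theorem not_critical2_of_isCut {G : SimpleGraph V} (hconn : G.Connected) {x : V} {A C : Set V}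
    (hcut : IsCut G x A C) {a b h k : V} (ha : a ∈ A) (hb : b ∈ A) (hab : a ≠ b)
    (hh : h ∈ C) (hk : k ∈ C) (hhk : h ≠ k) (ua : UniversalIn G A a) (ub : UniversalIn G A b)
    (uh : UniversalIn G C h) (uk : UniversalIn G C k) (hx : G.Adj h x) (kx : G.Adj k x) :
    ¬ Critical2 G := by
  have key : ∀ q, UniversalIn G C q → G.Adj q x → UniversalIn G Aᶜ q := by
    intro q uq hqx
    rw [hcut.compl_left]
    rintro z (rfl | hz)
    exacts [.inr hqx, uq z hz]
  exact not_critical2_of_universalIn hconn ha hb hab (fun h' => hcut.notMem_of_mem _ h' hh)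
    (fun h' => hcut.notMem_of_mem _ h' hk) hhk ua ub (key h uh hx) (key k uk kx)

theorem not_critical2_of_isCut_of_adj {G : SimpleGraph V} (hconn : G.Connected) {x : V}
    {A C : Set V} (hcut : IsCut G x A C) {d h k : V} (hd : d ∈ A) (hh : h ∈ C) (hk : k ∈ C)
    (hhk : h ≠ k) (ud : UniversalIn G A d) (hx : ∀ z ∈ A, G.Adj x z) (uh : UniversalIn G C h)
    (uk : UniversalIn G C k) : ¬ Critical2 G := by
  have hxC : ∀ {q}, q ∈ C → q ∈ (insert x A)ᶜ := fun hq => by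
    rw [← hcut.symm.compl_left, compl_compl]
    exact hq
  have e : (insert x A)ᶜ = C := by rw [← hcut.symm.compl_left, compl_compl]
  refine not_critical2_of_universalIn hconn (mem_insert_of_mem x hd) (mem_insert x A)
    (fun h' => hcut.notMem_left (h' ▸ hd)) (hxC hh) (hxC hk) hhk ?_ ?_ (e ▸ uh) (e ▸ uk)
  · rintro z (rfl | hz)
    exacts [.inr (hx d hd).symm, ud z hz]
  · rintro z (rfl | hz)
    exacts [.inl rfl, .inr (hx z hz)]

theorem Critical2.exists_universalIn_pair {G : SimpleGraph V} (hG : Critical2 G)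
    (hconn : G.Connected) {x : V} {A C : Set V} (hcut : IsCut G x A C) {d u v k : V}
    (hd : d ∈ A) (hu : u ∈ A) (hdu : d ≠ u) (hv : v ∈ C) (hk : k ∈ C) (hvk : v ≠ k)
    (ud : UniversalIn G A d) (uu : UniversalIn G A u) (uv : UniversalIn G C v)
    (uk : UniversalIn G C k) (hdx : G.Adj d x) (hvx : G.Adj v x) :
    ∃ b b', b ∈ A ∧ b' ∈ A ∧ b ≠ b' ∧ b ≠ d ∧ b' ≠ d ∧ UniversalIn G A b ∧
      UniversalIn G A b' := by
  have hA : ∀ p ∈ A, p ≠ d → UniversalIn G A p → ¬ G.Adj p x := fun p hp hpd up hpx =>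
    not_critical2_of_isCut hconn hcut.symm hv hk hvk hp hd hpd uv uk up ud hpx hdx hG
  have hC : ∀ q ∈ C, q ≠ v → UniversalIn G C q → ¬ G.Adj q x := fun q hq hqv uq hqx =>
    not_critical2_of_isCut hconn hcut hd hu hdu hq hv hqv ud uu uq uv hqx hvx hG
  have hAx : ∀ q ∈ C, ¬ Dominating G {x, q} := fun q hq hdom =>
    hA u hu hdu.symm uu (hcut.adj_of_dominating hq hdom u hu).symm
  have hCx : ∀ p ∈ A, ¬ Dominating G {x, p} := fun p hp hdom =>
    hC k hk hvk.symm uk (hcut.symm.adj_of_dominating hp hdom k hk).symm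
  have key : ∀ p q, p ≠ q → p ≠ d → q ≠ d → Dominating G {p, q} →
      (p ∈ A ∧ UniversalIn G A p ∧ q = v) ∨ (q ∈ A ∧ UniversalIn G A q ∧ p = v) := by
    have half : ∀ p ∈ A, ∀ q ∈ C, p ≠ d → Dominating G {p, q} → UniversalIn G A p ∧ q = v := by
      intro p hp q hq hpd hdom
      obtain ⟨up, uq, hx⟩ := hcut.universalIn_of_dominating hp hq hdom
      refine ⟨up, by_contra fun hqv => ?_⟩
      exact hx.elim (hA p hp hpd up) (hC q hq hqv uq)
    have nox : ∀ q, q ≠ x → ¬ Dominating G {x, q} := fun q hqx hdom =>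
      (hcut.cover q).elim hqx fun h => h.elim (fun h => hCx q h hdom) fun h => hAx q h hdom
    intro p q hpq hpd hqd hdom
    by_cases hpx : p = x
    · exact (nox q (hpx ▸ hpq.symm) (hpx ▸ hdom)).elim
    by_cases hqx : q = x
    · exact (nox p hpx (by rw [pair_comm, ← hqx]; exact hdom)).elim
    rcases hcut.mem_of_dominating hpx hqx hdom with ⟨h1, h2⟩ | ⟨h1, h2⟩
    · exact .inl ⟨h1, half p h1 q h2 hpd hdom⟩
    · exact .inr ⟨h2, half q h2 p h1 hqd (by rw [pair_comm]; exact hdom)⟩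
  have hvA : v ∉ A := fun h => hcut.notMem_of_mem v h hv
  obtain ⟨c, p, q, ⟨hcp, hcq, hpq, h1, h2⟩, hcd, hpd, hqd⟩ :=
    hG.1.1.exists_cherry_of_four (a := d) (b := u) (c := v) (d := k) (by
      have := hcut.notMem_of_mem
      simp only [List.nodup_cons, List.mem_cons, List.not_mem_nil, or_false, not_or,
        List.nodup_nil, not_false_eq_true, and_true]
      grind) d
  rcases key c p hcp hcd hpd h1 with ⟨h3, h4, h5⟩ | ⟨h3, h4, h5⟩ <;>
    rcases key c q hcq hcd hqd h2 with ⟨h6, h7, h8⟩ | ⟨h6, h7, h8⟩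
  · exact (hpq (h5.trans h8.symm)).elim
  · exact (hvA (h8 ▸ h3)).elim
  · exact (hvA (h5 ▸ h6)).elim
  · exact ⟨p, q, h3, h6, hpq, hpd, hqd, h4, h7⟩

theorem Critical2.inFamilyFF'_of_universalIn [Finite V] {G : SimpleGraph V} (hG : Critical2 G)
    (hconn : G.Connected) {x : V} {A C : Set V} (hcut : IsCut G x A C) {d u v k : V}
    (hd : d ∈ A) (hu : u ∈ A) (hdu : d ≠ u) (hv : v ∈ C) (hk : k ∈ C) (hvk : v ≠ k)
    (ud : UniversalIn G A d) (uu : UniversalIn G A u) (uv : UniversalIn G C v)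
    (uk : UniversalIn G C k) (hdx : G.Adj d x) (hvx : G.Adj v x) : InFamilyFF' G := by
  obtain ⟨a, b, ha, hb, hab, had, hbd, ua, ub⟩ :=
    hG.exists_universalIn_pair hconn hcut hd hu hdu hv hk hvk ud uu uv uk hdx hvx
  obtain ⟨h, l, hh, hl, hhl, hhv, hlv, uh, ul⟩ :=
    hG.exists_universalIn_pair hconn hcut.symm hv hk hvk hd hu hdu uv uk ud uu hvx hdx
  have hxA := hcut.notMem_left
  have hxC := hcut.notMem_right
  have hcov := hcut.cover
  have hdisj := hcut.notMem_of_mem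
  refine hG.inFamilyFF'_of_partition false (v := d) (x := v) (h := h) (k := l) (a := a) (b := b)
    (X := C \ {v, h, l}) (L := A \ {d, a, b}) ?_ ?_ ?_ ?_ ?_ (by simp) ?_ ?_ ?_ ?_ ?_ ?_ ?_
  · simp only [List.nodup_cons, List.mem_cons, List.not_mem_nil, or_false, not_or,
      List.nodup_nil, not_false_eq_true, and_true]
    grind
  · intro w hw
    have := hdisj w
    simp only [mem_sdiff, mem_insert_iff, mem_singleton_iff, List.mem_cons,
      List.not_mem_nil] at hw ⊢
    grind
  · intro w hw
    have := hdisj w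
    simp only [mem_sdiff, mem_insert_iff, mem_singleton_iff, List.mem_cons,
      List.not_mem_nil] at hw ⊢
    grind
  · intro w hw hX hL
    have := hcov w
    simp only [mem_sdiff, mem_insert_iff, mem_singleton_iff, List.mem_cons,
      List.not_mem_nil] at hw hX hL
    have : w = x := by grind
    exact this ▸ ⟨hdx, hvx⟩
  · refine fun _ => ⟨(ua b hb).resolve_left hab.symm, x, ?_, fun h => hxC h.1, fun h => hxA h.1⟩
    simp only [List.mem_cons, List.not_mem_nil]
    grind
  · exact (ud a ha).resolve_left had
  · exact (ud b hb).resolve_left hbd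
  · exact (uv h hh).resolve_left hhv
  · exact (uv l hl).resolve_left hlv
  · exact (uh l hl).resolve_left hhl.symm
  · intro w hw
    simp only [mem_sdiff, mem_insert_iff, mem_singleton_iff, not_or] at hw
    exact ⟨(ud w hw.1).resolve_left hw.2.1, (ua w hw.1).resolve_left hw.2.2.1,
      (ub w hw.1).resolve_left hw.2.2.2⟩
  · intro w hw
    simp only [mem_sdiff, mem_insert_iff, mem_singleton_iff, not_or] at hw
    exact ⟨(uv w hw.1).resolve_left hw.2.1, (uh w hw.1).resolve_left hw.2.2.1,
      (ul w hw.1).resolve_left hw.2.2.2⟩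

theorem Critical2.inFamilyFF'_of_adj_right [Finite V] {G : SimpleGraph V} (hG : Critical2 G)
    {x : V} {A C : Set V} (hcut : IsCut G x A C) (m : Bool) {d h k a b : V} {L : Set V}
    (hd : d ∈ A) (hh : h ∈ C) (hk : k ∈ C) (hhk : h ≠ k) (ud : UniversalIn G A d)
    (uh : UniversalIn G C h) (uk : UniversalIn G C k) (hCx : ∀ z ∈ C, G.Adj x z)
    (ha : a ∈ A) (hb : b ∈ A) (hab : a ≠ b) (had : a ≠ d) (hbd : b ≠ d)
    (hL : ∀ z ∈ L, z ∈ A ∧ z ≠ d ∧ z ≠ a ∧ z ≠ b ∧ G.Adj a z ∧ G.Adj b z)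
    (hM : ∀ z ∈ A, z ≠ d → z ≠ a → z ≠ b → z ∉ L → G.Adj x z)
    (hm : m = false → G.Adj a b ∧ ∃ z ∈ A, z ≠ d ∧ z ≠ a ∧ z ≠ b ∧ z ∉ L)
    (hm' : m = true → G.Adj x a ∧ G.Adj x b ∧ ∀ r ∈ L, ∃ r' ∈ L, r ≠ r') : InFamilyFF' G := by
  have hxA := hcut.notMem_left
  have hxC := hcut.notMem_right
  have hcov := hcut.cover
  have hdisj := hcut.notMem_of_mem
  refine hG.inFamilyFF'_of_partition m (v := d) (x := x) (h := h) (k := k) (a := a) (b := b)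
    (X := C \ {h, k}) (L := L) ?_ ?_ ?_ ?_ ?_ hm' ?_ ?_ ?_ ?_ ?_ ?_ ?_
  · simp only [List.nodup_cons, List.mem_cons, List.not_mem_nil, or_false, not_or,
      List.nodup_nil, not_false_eq_true, and_true]
    clear hL hM hm hm' hCx
    refine ⟨?_, ?_, ?_, ?_, ?_⟩ <;> grind
  · intro w hw
    have := hdisj w
    simp only [mem_sdiff, mem_insert_iff, mem_singleton_iff, List.mem_cons,
      List.not_mem_nil] at hw ⊢
    clear hL hM hm hm' hCx
    grind
  · intro w hw
    have := hdisj w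
    have := hL w hw
    simp only [mem_sdiff, mem_insert_iff, mem_singleton_iff, List.mem_cons,
      List.not_mem_nil] at hw ⊢
    clear hL hM hm hm' hCx
    grind
  · intro w hw hX hwL
    have := hcov w
    simp only [mem_sdiff, mem_insert_iff, mem_singleton_iff, List.mem_cons,
      List.not_mem_nil, or_false, not_or] at hw hX
    have hwA : w ∈ A := by clear hL hM hm hm' hCx; grind
    exact ⟨(ud w hwA).resolve_left hw.1, hM w hwA hw.1 hw.2.2.2.2.1 hw.2.2.2.2.2 hwL⟩
  · intro hm0
    obtain ⟨h1, z, hz, hz1, hz2, hz3, hz4⟩ := hm hm0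
    refine ⟨h1, z, ?_, fun h => hdisj z hz h.1, hz4⟩
    have := hdisj z hz
    simp only [List.mem_cons, List.not_mem_nil]
    clear hL hM hm hm' hCx
    grind
  · exact (ud a ha).resolve_left had
  · exact (ud b hb).resolve_left hbd
  · exact hCx h hh
  · exact hCx k hk
  · exact (uh k hk).resolve_left hhk.symm
  · intro w hw
    obtain ⟨h1, h2, -, -, h3⟩ := hL w hw
    exact ⟨(ud w h1).resolve_left h2, h3⟩
  · intro w hw
    simp only [mem_sdiff, mem_insert_iff, mem_singleton_iff, not_or] at hw
    exact ⟨hCx w hw.1, (uh w hw.1).resolve_left hw.2.1, (uk w hw.1).resolve_left hw.2.2⟩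

theorem Critical2.inFamilyFF'_of_dominating [Finite V] {G : SimpleGraph V} (hG : Critical2 G)
    (hconn : G.Connected) {x : V} {A C : Set V} (hcut : IsCut G x A C) {d h k a b : V}
    (hd : d ∈ A) (hh : h ∈ C) (hk : k ∈ C) (hhk : h ≠ k) (ud : UniversalIn G A d)
    (uh : UniversalIn G C h) (uk : UniversalIn G C k)
    (ha : a ∈ A) (hb : b ∈ A) (hab : a ≠ b) (had : a ≠ d) (hbd : b ≠ d)
    (hxa : Dominating G {x, a}) (hxb : Dominating G {x, b}) : InFamilyFF' G := by
  have hCx := hcut.symm.adj_of_dominating ha hxa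
  have huniv : ∀ c ∈ A, c ≠ d → ¬ UniversalIn G A c := fun c hc hcd uc =>
    not_critical2_of_isCut hconn hcut hc hd hcd hh hk hhk uc ud uh uk (hCx h hh).symm
      (hCx k hk).symm hG
  have hdom : ∀ c, c ∈ A → Dominating G {x, c} → ∀ z ∈ A, ¬ G.Adj x z → z ≠ c → G.Adj c z := by
    intro c hc hxc z hz hzx hzc
    rcases (dominating_pair_iff _ _ _).1 hxc z with h1 | h1 | h1 | h1
    exacts [(hcut.notMem_left (h1 ▸ hz)).elim, (hzc h1).elim, (hzx h1).elim, h1]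
  have hmid : ∀ c ∈ A, c ≠ d → Dominating G {x, c} →
      ∃ z ∈ A, z ≠ d ∧ z ≠ c ∧ ¬ G.Adj c z ∧ G.Adj x z := by
    intro c hc hcd hxc
    have h1 := huniv c hc hcd
    simp only [UniversalIn, not_forall, not_or] at h1
    obtain ⟨z, hz, hzc, hcz⟩ := h1
    refine ⟨z, hz, ?_, hzc, hcz, by_contra fun h1 => hcz (hdom c hc hxc z hz h1 hzc)⟩
    rintro rfl
    exact hcz ((ud c hc).resolve_left hcd).symm
  have hrest : ∀ a b, a ∈ A → b ∈ A → a ≠ b → a ≠ d → b ≠ d → Dominating G {x, a} →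
      Dominating G {x, b} → ¬ G.Adj x a → InFamilyFF' G := by
    intro a b ha hb hab had hbd hxa hxb hax
    have hba := hdom b hb hxb a ha hax hab
    obtain ⟨z, hz, hzd, hzb, hbz, hxz⟩ := hmid b hb hbd hxb
    refine hG.inFamilyFF'_of_adj_right hcut false hd hh hk hhk ud uh uk hCx ha hb hab had hbd
      (L := {z | z ∈ A ∧ z ≠ d ∧ z ≠ a ∧ z ≠ b ∧ ¬ G.Adj x z}) ?_ ?_ ?_ (by simp)
    · rintro z ⟨hz, hzd, hza, hzb, hzx⟩
      exact ⟨hz, hzd, hza, hzb, hdom a ha hxa z hz hzx hza, hdom b hb hxb z hz hzx hzb⟩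
    · intro z hz hzd hza hzb hzL
      by_contra hzx
      exact hzL ⟨hz, hzd, hza, hzb, hzx⟩
    · refine fun _ => ⟨hba.symm, z, hz, hzd, ?_, hzb, fun h => h.2.2.2.2 hxz⟩
      rintro rfl
      exact hbz hba
  by_cases hxa' : G.Adj x a
  swap
  · exact hrest a b ha hb hab had hbd hxa hxb hxa'
  by_cases hxb' : G.Adj x b
  swap
  · exact hrest b a hb ha hab.symm hbd had hxb hxa hxb'
  by_cases hR : ∃ r ∈ A, r ≠ d ∧ ¬ G.Adj x r ∧ ∀ z ∈ A, z ≠ d → ¬ G.Adj x z → z = r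
  · obtain ⟨r, hr, hrd, hxr, hr'⟩ := hR
    have hra : r ≠ a := fun h => hxr (h ▸ hxa')
    have hrb : r ≠ b := fun h => hxr (h ▸ hxb')
    refine hG.inFamilyFF'_of_adj_right hcut false hd hh hk hhk ud uh uk hCx hr ha hra hrd had
      (L := ∅) (by simp) ?_ ?_ (by simp)
    · intro z hz hzd hzr _ _
      by_contra hzx
      exact hzr (hr' z hz hzd hzx)
    · exact fun _ => ⟨(hdom a ha hxa r hr hxr hra).symm, b, hb, hbd, hrb.symm, hab.symm, by simp⟩
  · push Not at hR
    refine hG.inFamilyFF'_of_adj_right hcut true hd hh hk hhk ud uh uk hCx ha hb hab had hbd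
      (L := {z | z ∈ A ∧ z ≠ d ∧ ¬ G.Adj x z}) ?_ ?_ (by simp) ?_
    · rintro z ⟨hz, hzd, hzx⟩
      have hza : z ≠ a := fun h => hzx (h ▸ hxa')
      have hzb : z ≠ b := fun h => hzx (h ▸ hxb')
      exact ⟨hz, hzd, hza, hzb, hdom a ha hxa z hz hzx hza, hdom b hb hxb z hz hzx hzb⟩
    · intro z hz hzd _ _ hzL
      by_contra hzx
      exact hzL ⟨hz, hzd, hzx⟩
    · refine fun _ => ⟨hxa', hxb', ?_⟩
      rintro r ⟨hr, hrd, hrx⟩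
      obtain ⟨z, hz, hzd, hzx, hzr⟩ := hR r hr hrd hrx
      exact ⟨z, ⟨hz, hzd, hzx⟩, hzr.symm⟩

theorem Critical2.inFamilyFF'_of_cherry [Finite V] {G : SimpleGraph V} (hG : Critical2 G)
    (hconn : G.Connected) {x : V} {A C : Set V} (hcut : IsCut G x A C) {d h k : V}
    (hd : d ∈ A) (hh : h ∈ C) (hk : k ∈ C) (hhk : h ≠ k) (hdh : Dominating G {d, h})
    (hdk : Dominating G {d, k}) : InFamilyFF' G := by
  obtain ⟨ud, uh, hx⟩ := hcut.universalIn_of_dominating hd hh hdh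
  obtain ⟨-, uk, kx⟩ := hcut.universalIn_of_dominating hd hk hdk
  have hxv : ∀ v ∈ C, ¬ Dominating G {x, v} := fun v hv hdom =>
    not_critical2_of_isCut_of_adj hconn hcut hd hh hk hhk ud (hcut.adj_of_dominating hv hdom)
      uh uk hG
  have hpair : ∀ p q, p ∈ A → q ∈ C → p ≠ d → Dominating G {p, q} → InFamilyFF' G := by
    intro p q hp hq hpd hdom
    obtain ⟨up, uq, hpq⟩ := hcut.universalIn_of_dominating hp hq hdom
    have hdx : G.Adj d x := by
      by_contra hdx
      exact not_critical2_of_isCut hconn hcut hp hd hpd hh hk hhk up ud uh uk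
        (hx.resolve_left hdx) (kx.resolve_left hdx) hG
    obtain ⟨l, hl, hlq, ul⟩ : ∃ l ∈ C, q ≠ l ∧ UniversalIn G C l := by
      by_cases hqh : q = h
      · exact ⟨k, hk, hqh ▸ hhk, uk⟩
      · exact ⟨h, hh, hqh, uh⟩
    have hqx : G.Adj q x := hpq.resolve_left fun hpx =>
      not_critical2_of_isCut hconn hcut.symm hq hl hlq hp hd hpd uq ul up ud hpx hdx hG
    exact hG.inFamilyFF'_of_universalIn hconn hcut hd hp hpd.symm hq hl hlq ud up uq ul hdx hqx
  have hne := hcut.notMem_of_mem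
  obtain ⟨c, p, q, ⟨hcp, hcq, hpq, h1, h2⟩, hcd, hpd, hqd⟩ :=
    hG.1.1.exists_cherry_of_four (a := d) (b := x) (c := h) (d := k) (by
      have := hcut.notMem_left
      have := hcut.notMem_right
      simp only [List.nodup_cons, List.mem_cons, List.not_mem_nil, or_false, not_or,
        List.nodup_nil, not_false_eq_true, and_true]
      grind) d
  have hstep : ∀ p q, p ≠ x → q ≠ x → p ≠ d → q ≠ d → Dominating G {p, q} → InFamilyFF' G := by
    intro p q hpx hqx hpd hqd hdom
    rcases hcut.mem_of_dominating hpx hqx hdom with ⟨h3, h4⟩ | ⟨h3, h4⟩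
    · exact hpair p q h3 h4 hpd hdom
    · exact hpair q p h4 h3 hqd (by rwa [pair_comm])
  have hleft : ∀ p, p ≠ x → Dominating G {x, p} → p ∈ A := fun p hpx hdom =>
    ((hcut.cover p).resolve_left hpx).resolve_right fun hpC => hxv p hpC hdom
  by_cases hcx : c = x
  · subst hcx
    exact hG.inFamilyFF'_of_dominating hconn hcut hd hh hk hhk ud uh uk
      (hleft p hcp.symm h1) (hleft q hcq.symm h2) hpq hpd hqd h1 h2
  · by_cases hpx : p = x
    · exact hstep c q hcx (fun hqx => hpq (hpx.trans hqx.symm)) hcd hqd h2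
    · exact hstep c p hcx hpx hcd hpd h1

theorem Critical2.inFamilyFF' [Finite V] {G : SimpleGraph V} (hG : Critical2 G)
    (hconn : G.Connected) {x : V} (hx : ¬ (G.induce ({x}ᶜ : Set V)).Connected) :
    InFamilyFF' G := by
  obtain ⟨y, hy, -⟩ := hG.1.1 x
  obtain ⟨A, C, hcut⟩ := IsCut.exists_of_not_connected hy hx
  obtain ⟨a, ha⟩ := hcut.left_nonempty
  obtain ⟨c, hc⟩ := hcut.right_nonempty
  have hac : a ≠ c := fun h => hcut.notMem_of_mem a ha (h ▸ hc)
  have hax : a ≠ x := fun h => hcut.notMem_left (h ▸ ha)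
  have hcx : c ≠ x := fun h => hcut.notMem_right (h ▸ hc)
  obtain ⟨d, h, k, ⟨hdh, hdk, hhk, h1, h2⟩, hdx, hhx, hkx⟩ := hG.1.1.exists_cherry x
    (fun d _ => (ne_or_eq a d).elim (fun h => ⟨a, hax, h⟩) fun h => ⟨c, hcx, h ▸ hac.symm⟩)
    (fun d hdx hdom => by
      have hdd : Dominating G {d, d} := by rwa [pair_eq_singleton]
      rcases hcut.mem_of_dominating hdx hdx hdd with ⟨h1, h2⟩ | ⟨h1, h2⟩
      exacts [(hcut.notMem_of_mem d h1 h2).elim, (hcut.notMem_of_mem d h2 h1).elim])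
  rcases hcut.mem_of_dominating hdx hhx h1 with ⟨hd, hh⟩ | ⟨hd, hh⟩ <;>
    rcases hcut.mem_of_dominating hdx hkx h2 with ⟨hd', hk⟩ | ⟨hd', hk⟩
  · exact hG.inFamilyFF'_of_cherry hconn hcut hd hh hk hhk h1 h2
  · exact (hcut.notMem_of_mem d hd hd').elim
  · exact (hcut.notMem_of_mem d hd' hd).elim
  · exact hG.inFamilyFF'_of_cherry hconn hcut.symm hd hh hk hhk h1 h2

end

theorem stmt1 {V : Type*} [Fintype V] (G : SimpleGraph V)
    (hconn : G.Connected)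
    (hcut : ∃ x : V, ¬ (G.induce ({x}ᶜ : Set V)).Connected) :
    Critical2 G ↔ InFamilyFF' G := by
  obtain ⟨x, hx⟩ := hcut
  exact ⟨fun h => h.inFamilyFF' hconn hx, InFamilyFF'.critical2⟩
end

section
/- Let G be a finite connected 2-γ'MB-critical simple graph. Then the number of vertices n(G) is at least 5, the minimum degree δ(G) is at least 2, and the maximum degree Δ(G) is at most n(G) − 2. -/
theorem dominating_pair_iff_s14 {V : Type*} {G : SimpleGraph V} {d e : V} :
    Dominating G {d, e} ↔ ∀ x, x ≠ d → x ≠ e → G.Adj d x ∨ G.Adj e x := by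
  simp [Dominating]

theorem dominating_singleton_iff {V : Type*} {G : SimpleGraph V} {d : V} :
    Dominating G {d} ↔ ∀ x, x ≠ d → G.Adj d x := by
  simp [Dominating]

/-- Dominator wins within two moves if every first move of Staller has an answer that leaves two
distinct ways to complete a dominating pair. -/
theorem winsWithin2_of_two_options {V : Type*} {G : SimpleGraph V}
    (h : ∀ s : V, ∃ d p q, d ≠ s ∧ p ≠ q ∧ p ≠ s ∧ p ≠ d ∧ q ≠ s ∧ q ≠ d ∧
      (∀ x, x ≠ d → x ≠ p → G.Adj d x ∨ G.Adj p x) ∧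
      (∀ x, x ≠ d → x ≠ q → G.Adj d x ∨ G.Adj q x)) : WinsWithin2 G := by
  intro s
  obtain ⟨d, p, q, hds, hpq, hps, hpd, hqs, hqd, hp, hq⟩ := h s
  refine ⟨d, hds, Or.inr fun t _ => ?_⟩
  by_cases htp : t = p
  · exact ⟨q, by simp [hqs, hqd, htp, hpq.symm], dominating_pair_iff_s14.2 hq⟩
  · exact ⟨p, by simp [hps, hpd, Ne.symm htp], dominating_pair_iff_s14.2 hp⟩

/-- If Dominator wins within two moves, each first move of Staller has an answer that is dominating
or leaves two distinct ways to complete a dominating pair. -/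
theorem WinsWithin2.exists_two_options {V : Type*} {G : SimpleGraph V} (h : WinsWithin2 G) (s : V) :
    ∃ d, d ≠ s ∧ ((∀ x, x ≠ d → G.Adj d x) ∨ (∀ x, x = s ∨ x = d) ∨
      ∃ p q, p ≠ q ∧ p ≠ s ∧ p ≠ d ∧ q ≠ s ∧ q ≠ d ∧
      (∀ x, x ≠ d → x ≠ p → G.Adj d x ∨ G.Adj p x) ∧
      (∀ x, x ≠ d → x ≠ q → G.Adj d x ∨ G.Adj q x)) := by
  obtain ⟨d, hds, hd | hd⟩ := h s
  · exact ⟨d, hds, Or.inl (dominating_singleton_iff.1 hd)⟩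
  refine ⟨d, hds, Or.inr ?_⟩
  by_cases hx : ∀ x, x = s ∨ x = d
  · exact Or.inl hx
  push Not at hx
  obtain ⟨t, hts, htd⟩ := hx
  obtain ⟨p, hp, hpdom⟩ := hd t (by simp [hts, htd])
  simp only [Set.mem_insert_iff, Set.mem_singleton_iff, not_or] at hp
  obtain ⟨q, hq, hqdom⟩ := hd p (by simp [hp.1, hp.2.1])
  simp only [Set.mem_insert_iff, Set.mem_singleton_iff, not_or] at hq
  exact Or.inr ⟨p, q, Ne.symm hq.2.2, hp.1, hp.2.1, hq.1, hq.2.1,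
    dominating_pair_iff_s14.1 hpdom, dominating_pair_iff_s14.1 hqdom⟩

/-- An edge `uw` together with two distinct vertices, each dominating everything outside
`{u, w}`, gives Dominator a pairing strategy. -/
theorem winsWithin2_of_pairing {V : Type*} {G : SimpleGraph V} {u w a b : V} (huw : G.Adj u w)
    (hab : a ≠ b) (hau : a ≠ u) (haw : a ≠ w) (hbu : b ≠ u) (hbw : b ≠ w)
    (ha : ∀ x, x ≠ u → x ≠ w → x ≠ a → G.Adj a x)
    (hb : ∀ x, x ≠ u → x ≠ w → x ≠ b → G.Adj b x) : WinsWithin2 G := by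
  have hwu := huw.symm
  have hne := huw.ne
  apply winsWithin2_of_two_options
  intro s
  by_cases hsw : s = w
  · exact ⟨u, a, b, by grind⟩
  by_cases hsu : s = u
  · exact ⟨w, a, b, by grind⟩
  by_cases hsa : s = a
  · exact ⟨b, u, w, by grind⟩
  · exact ⟨a, u, w, by grind⟩

theorem deleteEdges_pair_adj {V : Type*} {G : SimpleGraph V} {u v x y : V} :
    (G.deleteEdges {s(u, v)}).Adj x y ↔
      G.Adj x y ∧ ¬ (x = u ∧ y = v) ∧ ¬ (x = v ∧ y = u) := by
  simp [SimpleGraph.deleteEdges_adj]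

theorem SimpleGraph.Connected.exists_adj_boundary {V : Type*} {G : SimpleGraph V}
    (h : G.Connected) {S : Set V} {x y : V} (hx : x ∈ S) (hy : y ∉ S) :
    ∃ a ∈ S, ∃ b ∉ S, G.Adj a b := by
  obtain ⟨p⟩ := h.preconnected x y
  obtain ⟨d, -, h₁, h₂⟩ := p.exists_boundary_dart S hx hy
  exact ⟨d.fst, h₁, d.snd, h₂, d.adj⟩

theorem Critical2.exists_two_neighbors {V : Type*} {G : SimpleGraph V}
    (hconn : G.Connected) (hcrit : Critical2 G) (u : V) :
    ∃ p q, p ≠ q ∧ G.Adj u p ∧ G.Adj u q := by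
  obtain ⟨⟨hwin, hnot⟩, hdel⟩ := hcrit
  obtain ⟨z, hzu, -⟩ := hwin u
  obtain ⟨y, hy, w, -, huw⟩ := hconn.exists_adj_boundary (S := {u}) rfl hzu
  rw [Set.mem_singleton_iff.1 hy] at huw
  by_contra! hleaf
  have hu : ∀ x, G.Adj u x → x = w := fun x hx => by
    by_contra hne
    exact hleaf x w hne hx huw
  have hwu := huw.symm
  have huw' := huw.ne
  have hcard : ¬ ∀ x, x = w ∨ x = u := by
    intro h
    apply hnot
    intro s
    by_cases hs : s = u
    · exact ⟨w, by grind, dominating_singleton_iff.2 fun x hx => by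
        rwa [(h x).resolve_left hx]⟩
    · exact ⟨u, Ne.symm hs, dominating_singleton_iff.2 fun x hx => by
        rwa [(h x).resolve_right hx]⟩
  obtain ⟨d, hdw, hd | hd | ⟨a, b, hab, haw, had, hbw, hbd, ha, hb⟩⟩ :=
    hwin.exists_two_options w
  · have hdu : d = u := by
      by_contra hdu
      exact hdw (hu d (hd u (Ne.symm hdu)).symm)
    subst hdu
    exact hcard fun x => or_iff_not_imp_right.2 fun hx => hu x (hd x hx)
  · refine hcard fun x => (hd x).imp_right fun hx => ?_
    rw [hx, (hd u).resolve_left huw']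
  have hdu : d = u := by
    by_contra hdu
    have h₁ := ha u (Ne.symm hdu)
    have h₂ := hb u (Ne.symm hdu)
    have h₃ := fun x (hx : G.Adj x u) => hu x hx.symm
    grind
  subst hdu
  obtain ⟨x, hx, y, hy, hxy⟩ :=
    hconn.exists_adj_boundary (S := {d, w}) (x := d) (y := a) (by simp) (by simp [had, haw])
  simp only [Set.mem_insert_iff, Set.mem_singleton_iff, not_or] at hx hy
  refine hdel x y hxy (winsWithin2_of_pairing (u := d) (w := w) (a := a) (b := b)
    ?_ hab had haw hbd hbw ?_ ?_)
  all_goals simp only [deleteEdges_pair_adj]; grind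

theorem Critical2.exists_not_adj {V : Type*} {G : SimpleGraph V}
    (hconn : G.Connected) (hcrit : Critical2 G) (v : V) :
    ∃ x, x ≠ v ∧ ¬ G.Adj v x := by
  have hdeg := hcrit.exists_two_neighbors hconn
  obtain ⟨⟨hwin, hnot⟩, hdel⟩ := hcrit
  by_contra! hv
  have huniv : ∀ d, d ≠ v → ¬ ∀ x, x ≠ d → G.Adj d x := by
    intro d hdv hd
    apply hnot
    intro s
    by_cases hs : s = v
    · exact ⟨d, by grind, dominating_singleton_iff.2 hd⟩
    · exact ⟨v, Ne.symm hs, dominating_singleton_iff.2 hv⟩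
  obtain ⟨d, hdv, hd | hd | ⟨a, b, hab, hav, had, hbv, hbd, ha, hb⟩⟩ :=
    hwin.exists_two_options v
  · exact huniv d hdv hd
  · exact huniv d hdv fun x hx => by
      rw [(hd x).resolve_right hx]
      exact (hv d hdv).symm
  have hvd := hv d hdv
  have hv' := fun x hx => (hv x hx).symm
  obtain ⟨c, hcv, hdc⟩ : ∃ c, c ≠ v ∧ G.Adj d c := by
    obtain ⟨p, q, hpq, hp, hq⟩ := hdeg d
    by_cases h : p = v
    · exact ⟨q, by grind, hq⟩
    · exact ⟨p, h, hp⟩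
  have hcd := hdc.symm
  have hdc' := hdc.ne
  obtain ⟨e, hec, hev, hed, he⟩ : ∃ e, e ≠ c ∧ e ≠ v ∧ e ≠ d ∧
      ∀ x, x ≠ d → x ≠ e → G.Adj d x ∨ G.Adj e x := by
    by_cases h : a = c
    · exact ⟨b, by grind, hbv, hbd, hb⟩
    · exact ⟨a, h, hav, had, ha⟩
  refine hdel v d hvd (winsWithin2_of_two_options ?_)
  simp only [deleteEdges_pair_adj]
  clear hdel hdeg hwin hnot hconn huniv
  intro s
  by_cases hsv : s = v
  · exact ⟨d, a, b, by grind⟩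
  by_cases hsc : s = c
  · exact ⟨d, v, e, by grind⟩
  by_cases hsd : s = d
  · by_cases hc : ∃ c', c' ≠ c ∧ c' ≠ v ∧ G.Adj d c'
    · obtain ⟨c', hc'c, hc'v, hdc₁⟩ := hc
      have hdc₂ := hdc₁.symm
      have hdc₃ := hdc₁.ne
      exact ⟨v, c, c', by grind⟩
    · push Not at hc
      refine ⟨c, v, e, by grind, by grind, by grind, by grind, by grind, by grind, ?_, ?_⟩
      · intro x hxc hxv
        have := hv x hxv
        grind
      · intro x hxc hxe
        by_cases hxv : x = v
        · have := hv' c hcv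
          grind
        by_cases hxd : x = d
        · grind
        have := (he x hxd hxe).resolve_left (hc x hxc hxv)
        grind
  · exact ⟨v, d, c, by grind⟩

theorem Critical2.five_le_card {V : Type*} [Fintype V] {G : SimpleGraph V}
    (hconn : G.Connected) (hcrit : Critical2 G) : 5 ≤ Fintype.card V := by
  classical
  obtain ⟨v⟩ := hconn.nonempty
  obtain ⟨a, b, hab, hva, hvb⟩ := hcrit.exists_two_neighbors hconn v
  obtain ⟨x, hxv, hvx⟩ := hcrit.exists_not_adj hconn v
  have hxa : x ≠ a := by grind
  have hxb : x ≠ b := by grind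
  have hva' := hva.ne
  have hvb' := hvb.ne
  have hcard : ({v, a, b, x} : Finset V).card = 4 := by
    simp [Finset.card_insert_of_notMem, *, Ne.symm hxv, Ne.symm hxa, Ne.symm hxb]
  by_contra! hlt
  have hall : ∀ y, y = v ∨ y = a ∨ y = b ∨ y = x := by
    have h : ({v, a, b, x} : Finset V) = Finset.univ :=
      Finset.eq_univ_of_card _ (le_antisymm (Finset.card_le_univ _) (by omega))
    intro y
    have := h ▸ Finset.mem_univ y
    simpa using this
  obtain ⟨p, q, hpq, hp, hq⟩ := hcrit.exists_two_neighbors hconn x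
  have hpx := hp.ne
  have hqx := hq.ne
  have hxv' : ¬ G.Adj x v := fun h => hvx h.symm
  have hxa' : G.Adj x a := by
    have := hall p
    have := hall q
    grind
  have hax := hxa'.symm
  refine hcrit.2 v a hva (winsWithin2_of_pairing (u := v) (w := b) (a := a) (b := x)
    ?_ hxa.symm ?_ ?_ ?_ ?_ ?_ ?_)
  · simp only [deleteEdges_pair_adj]
    grind
  any_goals grind
  all_goals
    simp only [deleteEdges_pair_adj]
    intro y
    have := hall y
    grind

theorem stmt14 {V : Type*} [Fintype V] (G : SimpleGraph V)
    (hconn : G.Connected) (hcrit : Critical2 G) :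
    5 ≤ Fintype.card V ∧ (∀ v : V, 2 ≤ (G.neighborSet v).ncard) ∧
      (∀ v : V, (G.neighborSet v).ncard ≤ Fintype.card V - 2) := by
  refine ⟨hcrit.five_le_card hconn, fun v => ?_, fun v => ?_⟩
  · obtain ⟨p, q, hpq, hp, hq⟩ := hcrit.exists_two_neighbors hconn v
    rw [← Set.ncard_pair hpq]
    exact Set.ncard_le_ncard (by rintro y (rfl | rfl) <;> assumption)
  · obtain ⟨x, hxv, hvx⟩ := hcrit.exists_not_adj hconn v
    have hsub : G.neighborSet v ⊆ ({v, x} : Set V)ᶜ := by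
      rintro y hy (rfl | rfl)
      · exact G.loopless.irrefl _ hy
      · exact hvx hy
    have h := Set.ncard_le_ncard hsub
    rwa [Set.ncard_compl, Set.ncard_pair hxv.symm, Nat.card_eq_fintype_card] at h
end
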